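/- arXiv:1503.02307 — 3 statements merged into one kernel-verified Lean document; each statement's English description precedes it below -/
import Mathlib

section
/- For every positive integer $m$ and every $z\in\mathbb{R}$ one has $1 \ge 1-\mathrm{sinc}^2(mz) \ge \tfrac16\big(\min\{|z|,2\}\big)^2$, where $\mathrm{sinc}(z):=\sin(z)/z$ for $z\neq0$ and $\mathrm{sinc}(0):=1$. -/
/-- `sinc z = sin z / z` for `z ≠ 0`, `sinc 0 = 1`. -/
noncomputable def sinc (z : ℝ) : ℝ := if z = 0 then 1 else Real.sin z / z

theorem sin_sq_le_sq_mul_one_sub {w : ℝ} (hw : w ^ 2 ≤ 4) :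
    Real.sin w ^ 2 ≤ w ^ 2 * (1 - w ^ 2 / 6) := by
  rcases le_total (w ^ 2) 2 with h | h
  · have hdouble : Real.sin w ^ 2 = 4 * Real.sin (w / 2) ^ 2 * (1 - Real.sin (w / 2) ^ 2) := by
      rw [← Real.cos_sq', show Real.sin w = Real.sin (2 * (w / 2)) by ring_nf, Real.sin_two_mul]
      ring
    have hhalf : Real.sin (w / 2) ^ 2 ≤ (w / 2) ^ 2 := Real.sin_sq_le_sq
    rw [hdouble]
    nlinarith [mul_nonneg (sub_nonneg.2 hhalf)
      (show 0 ≤ 1 - (w / 2) ^ 2 - Real.sin (w / 2) ^ 2 by linarith), sq_nonneg (w ^ 2)]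
  · nlinarith [Real.sin_sq_le_one w, mul_nonneg (sub_nonneg.2 h) (sub_nonneg.2 hw)]

theorem min_sq_div_six_le_one_sub_sinc_sq (w : ℝ) :
    min (w ^ 2) 4 / 6 ≤ 1 - sinc w ^ 2 := by
  rcases eq_or_ne w 0 with rfl | h0
  · simp [sinc]
  have hpos : 0 < w ^ 2 := by positivity
  rw [sinc, if_neg h0, div_pow, le_sub_comm, div_le_iff₀ hpos]
  rcases le_total (w ^ 2) 4 with h | h
  · rw [min_eq_left h]
    linarith [sin_sq_le_sq_mul_one_sub h]
  · rw [min_eq_right h]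
    linarith [Real.sin_sq_le_one w]

/-- For every positive integer `m` and every real `z`:
`1 ≥ 1 - sinc²(mz) ≥ (min{|z|,2})²/6`. -/
theorem one_sub_sinc_sq_bounds (m : ℕ) (hm : 1 ≤ m) (z : ℝ) :
    1 - sinc ((m : ℝ) * z) ^ 2 ≤ 1 ∧
      (min |z| 2) ^ 2 / 6 ≤ 1 - sinc ((m : ℝ) * z) ^ 2 := by
  refine ⟨sub_le_self _ (sq_nonneg _), le_trans ?_ (min_sq_div_six_le_one_sub_sinc_sq _)⟩
  have hm' : (1 : ℝ) ≤ (m : ℝ) ^ 2 := one_le_pow₀ (by exact_mod_cast hm)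
  have hmin : 0 ≤ min |z| 2 := le_min (abs_nonneg z) zero_le_two
  have hz : min |z| 2 ^ 2 ≤ z ^ 2 := by
    rw [← sq_abs z]
    exact pow_le_pow_left₀ hmin (min_le_left _ _) 2
  have htwo : min |z| 2 ^ 2 ≤ 4 :=
    (pow_le_pow_left₀ hmin (min_le_right _ _) 2).trans_eq (by norm_num)
  gcongr
  refine le_min (hz.trans ?_) htwo
  rw [mul_pow]
  exact le_mul_of_one_le_left (sq_nonneg z) hm'
end

section
/- Let $M\ge1$ and $\alpha_1,\dots,\alpha_M>0$, and for $\varepsilon>0$ define the symbol $b_\varepsilon(k) = 1 + \sum_{m=1}^M \alpha_m m^2 \varepsilon^{-2}\big(1-\mathrm{sinc}^2(m\varepsilon k/2)\big)$. Then there exists a constant $c>0$, independent of $\varepsilon$ and $k$, such that for all $0<\varepsilon\le 1$: $b_\varepsilon(k) \ge c(1+k^2)$ whenever $|k|\le 4/\varepsilon$, and $b_\varepsilon(k) \ge c/\varepsilon^2$ whenever $|k| > 4/\varepsilon$. -/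
/-- The Fourier symbol `b_ε` of the operator `ℬ_ε`. -/
noncomputable def bSymbol (M : ℕ) (α : ℕ → ℝ) (ε : ℝ) (k : ℝ) : ℝ :=
  1 + ∑ m ∈ Finset.Icc 1 M, α m * (m : ℝ) ^ 2 *
    (1 - sinc ((m : ℝ) * ε * k / 2) ^ 2) / ε ^ 2

theorem sinc_sq_le_one (z : ℝ) : sinc z ^ 2 ≤ 1 :=
  (sq_le_one_iff_abs_le_one _).mpr (Real.abs_sinc_le_one z)

theorem sinc_sq_eq {z : ℝ} (hz : z ≠ 0) : sinc z ^ 2 = Real.sin z ^ 2 / z ^ 2 := by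
  rw [sinc, if_neg hz, div_pow]

/-- Comes from `sin z = 2 sin (z / 2) cos (z / 2)` and Jordan's inequality at `z / 2`. -/
theorem sin_sq_le_sq_sub_pow_four {z : ℝ} (hz : |z| ≤ 2) :
    Real.sin z ^ 2 ≤ z ^ 2 - z ^ 4 / 64 := by
  wlog h0 : 0 ≤ z generalizing z
  · have := this (z := -z) (by rwa [abs_neg]) (by linarith)
    simpa [Even.neg_pow (by decide : Even 4)] using this
  obtain ⟨w, rfl⟩ : ∃ w, z = 2 * w := ⟨z / 2, by ring⟩
  have hw : 0 ≤ w := by linarith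
  have hw1 : w ≤ 1 := by linarith [le_abs_self (2 * w)]
  have hlow : w / 2 ≤ Real.sin w := by
    refine le_trans ?_ (Real.mul_le_sin hw (by linarith [Real.pi_gt_three]))
    have : 1 / 2 ≤ 2 / Real.pi := by
      rw [div_le_div_iff₀ two_pos Real.pi_pos]
      linarith [Real.pi_le_four]
    nlinarith
  have hup : Real.sin w ^ 2 ≤ w ^ 2 :=
    pow_le_pow_left₀ (by linarith) (Real.sin_le hw) 2
  have hsq : (w / 2) ^ 2 ≤ Real.sin w ^ 2 := pow_le_pow_left₀ (by linarith) hlow 2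
  have hfour : ((w / 2) ^ 2) ^ 2 ≤ (Real.sin w ^ 2) ^ 2 :=
    pow_le_pow_left₀ (by positivity) hsq 2
  rw [Real.sin_two_mul, mul_pow, Real.cos_sq']
  nlinarith

theorem sq_div_le_one_sub_sinc_sq {z : ℝ} (hz : |z| ≤ 2) :
    z ^ 2 / 64 ≤ 1 - sinc z ^ 2 := by
  rcases eq_or_ne z 0 with rfl | h
  · simp [sinc]
  · have hz2 : 0 < z ^ 2 := by positivity
    have : Real.sin z ^ 2 / z ^ 2 ≤ 1 - z ^ 2 / 64 := by
      rw [div_le_iff₀ hz2]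
      linarith [sin_sq_le_sq_sub_pow_four hz]
    rw [sinc_sq_eq h]
    linarith

theorem three_fourths_le_one_sub_sinc_sq {z : ℝ} (hz : 2 < |z|) :
    3 / 4 ≤ 1 - sinc z ^ 2 := by
  have h : z ≠ 0 := abs_pos.mp (by linarith)
  have hz2 : 4 < z ^ 2 := by nlinarith [sq_abs z]
  have : Real.sin z ^ 2 / z ^ 2 ≤ 1 / 4 := by
    rw [div_le_iff₀ (by linarith)]
    linarith [Real.sin_sq_le_one z]
  rw [sinc_sq_eq h]
  linarith

/-- The `m = 1` term alone bounds the symbol from below. -/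
theorem first_term_le_bSymbol {M : ℕ} (hM : 1 ≤ M) {α : ℕ → ℝ}
    (hα : ∀ m ∈ Finset.Icc 1 M, 0 < α m) (ε k : ℝ) :
    1 + α 1 * (1 - sinc (ε * k / 2) ^ 2) / ε ^ 2 ≤ bSymbol M α ε k := by
  have := Finset.single_le_sum (s := Finset.Icc 1 M)
    (f := fun m : ℕ => α m * (m : ℝ) ^ 2 * (1 - sinc ((m : ℝ) * ε * k / 2) ^ 2) / ε ^ 2)
    (fun m hm => div_nonneg (mul_nonneg (mul_nonneg (hα m hm).le (sq_nonneg _))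
      (sub_nonneg.mpr (sinc_sq_le_one _))) (sq_nonneg _))
    (Finset.mem_Icc.mpr ⟨le_rfl, hM⟩)
  simp only [Nat.cast_one, one_pow, mul_one, one_mul] at this
  unfold bSymbol
  linarith

/-- There is `c > 0`, independent of `ε` and `k`, such that for `0 < ε ≤ 1`:
`b_ε(k) ≥ c (1 + k²)` for `|k| ≤ 4/ε` and `b_ε(k) ≥ c/ε²` for `|k| > 4/ε`. -/
theorem bSymbol_lower_bounds (M : ℕ) (hM : 1 ≤ M) (α : ℕ → ℝ)
    (hα : ∀ m ∈ Finset.Icc 1 M, 0 < α m) :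
    ∃ c : ℝ, 0 < c ∧ ∀ ε : ℝ, 0 < ε → ε ≤ 1 → ∀ k : ℝ,
      (|k| ≤ 4 / ε → c * (1 + k ^ 2) ≤ bSymbol M α ε k) ∧
      (4 / ε < |k| → c / ε ^ 2 ≤ bSymbol M α ε k) := by
  have hα1 : 0 < α 1 := hα 1 (Finset.mem_Icc.mpr ⟨le_rfl, hM⟩)
  refine ⟨min 1 (α 1 / 256), by positivity, fun ε hε _ k => ?_⟩
  have hb := first_term_le_bSymbol hM hα ε k
  have hc1 : min 1 (α 1 / 256) ≤ 1 := min_le_left _ _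
  have hc2 : min 1 (α 1 / 256) ≤ α 1 / 256 := min_le_right _ _
  have habs : |ε * k / 2| = |k| * ε / 2 := by
    rw [abs_div, abs_mul, abs_of_pos hε, abs_two, mul_comm]
  constructor
  · intro hk
    rw [le_div_iff₀ hε] at hk
    have hs := sq_div_le_one_sub_sinc_sq (z := ε * k / 2) (by linarith)
    have hterm : α 1 / 256 * k ^ 2 ≤ α 1 * (1 - sinc (ε * k / 2) ^ 2) / ε ^ 2 := by
      rw [le_div_iff₀ (by positivity)]
      linarith [mul_le_mul_of_nonneg_left hs hα1.le]
    linarith [mul_le_mul_of_nonneg_right hc2 (sq_nonneg k)]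
  · intro hk
    rw [div_lt_iff₀ hε] at hk
    have hs := three_fourths_le_one_sub_sinc_sq (z := ε * k / 2) (by linarith)
    have hterm : min 1 (α 1 / 256) / ε ^ 2 ≤ α 1 * (1 - sinc (ε * k / 2) ^ 2) / ε ^ 2 := by
      gcongr
      linarith [mul_le_mul_of_nonneg_left hs hα1.le]
    linarith
end

section
/- Let $M\ge1$, $\alpha_1,\dots,\alpha_M>0$, $\beta_1,\dots,\beta_M>0$, set $d_1=12/\sum_{m=1}^M\alpha_m m^4$, $d_2=12\sum_{m=1}^M\beta_m m^3/\sum_{m=1}^M\alpha_m m^4$, and let $W_0(x)=\tfrac{3d_1}{2d_2}\mathrm{sech}^2(\tfrac12\sqrt{d_1}x)$. For $\varepsilon>0$ define $\mathcal{B}_\varepsilon := \mathrm{id} + \sum_{m=1}^M \alpha_m m^2\varepsilon^{-2}(\mathrm{id}-\mathcal{A}_{m\varepsilon}^2)$ and $\mathcal{Q}_\varepsilon[W] := \sum_{m=1}^M\beta_m m^3\,\mathcal{A}_{m\varepsilon}\big((\mathcal{A}_{m\varepsilon}W)^2\big)$. Then there exists a constant $C$ such that for all $0<\varepsilon\le 1$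 one has $\big\|\varepsilon^{-2}\big(\mathcal{Q}_\varepsilon[W_0]-\mathcal{B}_\varepsilon W_0\big)\big\|_2 \le C$. -/
open MeasureTheory

/-- The averaging operator `𝒜_η`: `(𝒜_η Y)(x) = η⁻¹ ∫_{x-η/2}^{x+η/2} Y(ξ) dξ`. -/
noncomputable def avg (η : ℝ) (Y : ℝ → ℝ) (x : ℝ) : ℝ :=
  η⁻¹ * ∫ ξ in (x - η/2)..(x + η/2), Y ξ

/-- The operator `ℬ_ε = id + ∑_{m=1}^M α_m m² ε⁻² (id - 𝒜_{mε}²)`. -/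
noncomputable def Bop (M : ℕ) (α : ℕ → ℝ) (ε : ℝ) (W : ℝ → ℝ) : ℝ → ℝ :=
  fun x => W x + ∑ m ∈ Finset.Icc 1 M, α m * (m : ℝ) ^ 2 / ε ^ 2 *
    (W x - avg ((m : ℝ) * ε) (avg ((m : ℝ) * ε) W) x)

/-- The quadratic operator `𝒬_ε[W] = ∑_{m=1}^M β_m m³ 𝒜_{mε}((𝒜_{mε}W)²)`. -/
noncomputable def Qop (M : ℕ) (β : ℕ → ℝ) (ε : ℝ) (W : ℝ → ℝ) : ℝ → ℝ :=
  fun x => ∑ m ∈ Finset.Icc 1 M, β m * (m : ℝ) ^ 3 *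
    avg ((m : ℝ) * ε) (fun y => avg ((m : ℝ) * ε) W y ^ 2) x

/-- The KdV solitary-wave profile `W₀(x) = (3d₁/(2d₂)) sech²(√d₁ x / 2)`. -/
noncomputable def W0 (d1 d2 : ℝ) (x : ℝ) : ℝ :=
  3 * d1 / (2 * d2) * (Real.cosh (Real.sqrt d1 * x / 2))⁻¹ ^ 2

/-- A function vanishing at `0` whose derivative is `O(t ^ n)` on `[0, T]` is `O(t ^ (n + 1))`. -/
lemma abs_le_pow_succ_of_abs_deriv_le {φ φ' : ℝ → ℝ} {B T : ℝ} {n : ℕ} (hB : 0 ≤ B)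
    (h0 : φ 0 = 0) (hφ : ∀ t, HasDerivAt φ (φ' t) t)
    (hφ' : ∀ t, 0 ≤ t → t ≤ T → |φ' t| ≤ B * t ^ n) (t : ℝ) (ht0 : 0 ≤ t) (htT : t ≤ T) :
    |φ t| ≤ B * t ^ (n + 1) := by
  have h := (convex_Icc 0 t).norm_image_sub_le_of_norm_hasDerivWithin_le (f := φ) (f' := φ')
    (C := B * t ^ n) (x := 0) (y := t) (fun s _ => (hφ s).hasDerivWithinAt)
    (fun s hs => (hφ' s hs.1 (hs.2.trans htT)).trans <| by
      have := pow_le_pow_left₀ hs.1 hs.2 n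
      gcongr) ⟨le_rfl, ht0⟩ ⟨ht0, le_rfl⟩
  simpa [h0, abs_of_nonneg ht0, pow_succ, mul_assoc] using h

lemma continuous_avg {f : ℝ → ℝ} (hf : Continuous f) (η : ℝ) : Continuous (avg η f) := by
  have hF : Continuous fun u => ∫ ξ in (0 : ℝ)..u, f ξ :=
    intervalIntegral.continuous_primitive (fun a b => hf.intervalIntegrable a b) 0
  have h : avg η f = fun x =>
      η⁻¹ * ((∫ ξ in (0 : ℝ)..(x + η / 2), f ξ) - ∫ ξ in (0 : ℝ)..(x - η / 2), f ξ) := by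
    funext x
    rw [avg, intervalIntegral.integral_interval_sub_left] <;> exact hf.intervalIntegrable _ _
  rw [h]
  exact continuous_const.mul ((hF.comp (by fun_prop)).sub (hF.comp (by fun_prop)))

lemma avg_sub {f g : ℝ → ℝ} (hf : Continuous f) (hg : Continuous g) (η x : ℝ) :
    avg η (fun y => f y - g y) x = avg η f x - avg η g x := by
  simp only [avg]
  rw [intervalIntegral.integral_sub (hf.intervalIntegrable _ _) (hg.intervalIntegrable _ _),
    mul_sub]

lemma avg_const_mul (f : ℝ → ℝ) (c η x : ℝ) :
    avg η (fun y => c * f y) x = c * avg η f x := by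
  simp only [avg]
  rw [intervalIntegral.integral_const_mul]
  ring

lemma hasDerivAt_comp_add {f : ℝ → ℝ} {f' x t : ℝ} (hf : HasDerivAt f f' (x + t)) :
    HasDerivAt (fun s => f (x + s)) f' t := by
  simpa using HasDerivAt.comp_const_add x t hf

lemma hasDerivAt_comp_sub {f : ℝ → ℝ} {f' x t : ℝ} (hf : HasDerivAt f f' (x - t)) :
    HasDerivAt (fun s => f (x - s)) (-f') t := by
  simpa using HasDerivAt.comp_const_sub x t hf

lemma hasDerivAt_integral_symm {f : ℝ → ℝ} (hf : Continuous f) (x t : ℝ) :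
    HasDerivAt (fun s => ∫ ξ in (x - s)..(x + s), f ξ) (f (x + t) + f (x - t)) t := by
  have hF : ∀ u, HasDerivAt (fun u => ∫ ξ in (0 : ℝ)..u, f ξ) (f u) u := fun u =>
    intervalIntegral.integral_hasDerivAt_right (hf.intervalIntegrable _ _)
      (hf.stronglyMeasurableAtFilter _ _) hf.continuousAt
  have h : (fun s => ∫ ξ in (x - s)..(x + s), f ξ) = fun s =>
      (∫ ξ in (0 : ℝ)..(x + s), f ξ) - ∫ ξ in (0 : ℝ)..(x - s), f ξ := by
    funext s
    rw [intervalIntegral.integral_interval_sub_left] <;> exact hf.intervalIntegrable _ _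
  rw [h]
  simpa using (hasDerivAt_comp_add (hF (x + t))).fun_sub (hasDerivAt_comp_sub (hF (x - t)))

section Weighted

variable {E : ℝ → ℝ} {L R K : ℝ}

lemma abs_avg_le {f : ℝ → ℝ} (hE : ∀ x t, |t| ≤ R → E (x + t) ≤ L * E x) (hK : 0 ≤ K)
    (hf : ∀ x, |f x| ≤ K * E x) {η : ℝ} (hη : 0 < η) (hηR : η ≤ R) (x : ℝ) :
    |avg η f x| ≤ K * L * E x := by
  have h := intervalIntegral.norm_integral_le_of_norm_le_const (f := f) (a := x - η / 2)
    (b := x + η / 2) (C := K * (L * E x)) (fun ξ hξ => by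
      rw [Set.uIoc_of_le (by linarith)] at hξ
      have := hE x (ξ - x) (abs_le.2 ⟨by linarith [hξ.1], by linarith [hξ.2]⟩)
      rw [add_sub_cancel] at this
      exact (hf ξ).trans (mul_le_mul_of_nonneg_left this hK))
  rw [show x + η / 2 - (x - η / 2) = η by ring, abs_of_pos hη, Real.norm_eq_abs] at h
  rw [avg, abs_mul, abs_inv, abs_of_pos hη, inv_mul_le_iff₀ hη]
  linarith

lemma abs_shift_le {f : ℝ → ℝ} (hE : ∀ x t, |t| ≤ R → E (x + t) ≤ L * E x) (hK : 0 ≤ K)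
    (hf : ∀ x, |f x| ≤ K * E x) (x t : ℝ) (ht : 0 ≤ t) (htR : t ≤ R) :
    |f (x + t) + f (x - t)| ≤ 2 * (K * L * E x) := by
  have h1 := hE x t (by rwa [abs_of_nonneg ht])
  have h2 := hE x (-t) (by rwa [abs_neg, abs_of_nonneg ht])
  rw [← sub_eq_add_neg] at h2
  have := mul_le_mul_of_nonneg_left h1 hK
  have := mul_le_mul_of_nonneg_left h2 hK
  have := abs_add_le (f (x + t)) (f (x - t))
  have := hf (x + t)
  have := hf (x - t)
  linarith

lemma abs_avg_sub_le {f f₁ f₂ : ℝ → ℝ} (hE : ∀ x t, |t| ≤ R → E (x + t) ≤ L * E x)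
    (hE0 : ∀ x, 0 ≤ E x) (hL : 0 ≤ L) (hK : 0 ≤ K) (h₁ : ∀ x, HasDerivAt f (f₁ x) x)
    (h₂ : ∀ x, HasDerivAt f₁ (f₂ x) x) (hf₂ : ∀ x, |f₂ x| ≤ K * E x)
    {η : ℝ} (hη : 0 < η) (hηR : η ≤ R) (x : ℝ) :
    |avg η f x - f x| ≤ K * L * E x * η ^ 2 := by
  have hf : Continuous f := continuous_iff_continuousAt.2 fun x => (h₁ x).continuousAt
  have hN : 0 ≤ K * L * E x := by have := hE0 x; positivity
  have hB : 0 ≤ 2 * (K * L * E x) := by linarith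
  have b₂ := abs_le_pow_succ_of_abs_deriv_le (n := 0) (T := R) hB
    (φ := fun t => f₁ (x + t) - f₁ (x - t)) (φ' := fun t => f₂ (x + t) + f₂ (x - t)) (by simp)
    (fun t => by simpa using
      (hasDerivAt_comp_add (h₂ (x + t))).fun_sub (hasDerivAt_comp_sub (h₂ (x - t))))
    (fun t h0 hT => by simpa using abs_shift_le hE hK hf₂ x t h0 hT)
  have b₁ := abs_le_pow_succ_of_abs_deriv_le (T := R) hB
    (φ := fun t => f (x + t) + f (x - t) - 2 * f x) (by simp; ring)
    (fun t => (((hasDerivAt_comp_add (h₁ (x + t))).fun_add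
      (hasDerivAt_comp_sub (h₁ (x - t)))).sub_const (2 * f x)).congr_deriv
        (sub_eq_add_neg _ _).symm) b₂
  have b₀ := abs_le_pow_succ_of_abs_deriv_le (T := R) hB
    (φ := fun t => (∫ ξ in (x - t)..(x + t), f ξ) - t * (2 * f x)) (by simp)
    (fun t => by simpa using
      (hasDerivAt_integral_symm hf x t).fun_sub ((hasDerivAt_id t).mul_const (2 * f x))) b₁
    (η / 2) (by linarith) (by linarith)
  have e : avg η f x - f x
      = η⁻¹ * ((∫ ξ in (x - η / 2)..(x + η / 2), f ξ) - η / 2 * (2 * f x)) := by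
    rw [avg]; field_simp
  rw [e, abs_mul, abs_inv, abs_of_pos hη, inv_mul_le_iff₀ hη]
  refine b₀.trans ?_
  have : 0 ≤ K * L * E x * η ^ 3 := by positivity
  linarith

lemma abs_avg_sub_sub_le {f f₁ f₂ f₃ f₄ : ℝ → ℝ}
    (hE : ∀ x t, |t| ≤ R → E (x + t) ≤ L * E x)
    (hE0 : ∀ x, 0 ≤ E x) (hL : 0 ≤ L) (hK : 0 ≤ K) (h₁ : ∀ x, HasDerivAt f (f₁ x) x)
    (h₂ : ∀ x, HasDerivAt f₁ (f₂ x) x) (h₃ : ∀ x, HasDerivAt f₂ (f₃ x) x)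
    (h₄ : ∀ x, HasDerivAt f₃ (f₄ x) x) (hf₄ : ∀ x, |f₄ x| ≤ K * E x)
    {η : ℝ} (hη : 0 < η) (hηR : η ≤ R) (x : ℝ) :
    |avg η f x - f x - η ^ 2 / 24 * f₂ x| ≤ K * L * E x * η ^ 4 := by
  have hf : Continuous f := continuous_iff_continuousAt.2 fun x => (h₁ x).continuousAt
  have hN : 0 ≤ K * L * E x := by have := hE0 x; positivity
  have hB : 0 ≤ 2 * (K * L * E x) := by linarith
  have b₄ := abs_le_pow_succ_of_abs_deriv_le (n := 0) (T := R) hB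
    (φ := fun t => f₃ (x + t) - f₃ (x - t)) (φ' := fun t => f₄ (x + t) + f₄ (x - t)) (by simp)
    (fun t => by simpa using
      (hasDerivAt_comp_add (h₄ (x + t))).fun_sub (hasDerivAt_comp_sub (h₄ (x - t))))
    (fun t h0 hT => by simpa using abs_shift_le hE hK hf₄ x t h0 hT)
  have b₃ := abs_le_pow_succ_of_abs_deriv_le (T := R) hB
    (φ := fun t => f₂ (x + t) + f₂ (x - t) - 2 * f₂ x) (by simp; ring)
    (fun t => (((hasDerivAt_comp_add (h₃ (x + t))).fun_add
      (hasDerivAt_comp_sub (h₃ (x - t)))).sub_const (2 * f₂ x)).congr_deriv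
        (sub_eq_add_neg _ _).symm) b₄
  have b₂ := abs_le_pow_succ_of_abs_deriv_le (T := R) hB
    (φ := fun t => f₁ (x + t) - f₁ (x - t) - t * (2 * f₂ x)) (by simp)
    (fun t => (((hasDerivAt_comp_add (h₂ (x + t))).fun_sub
      (hasDerivAt_comp_sub (h₂ (x - t)))).fun_sub
      ((hasDerivAt_id t).mul_const (2 * f₂ x))).congr_deriv (by ring)) b₃
  have b₁ := abs_le_pow_succ_of_abs_deriv_le (T := R) hB
    (φ := fun t => f (x + t) + f (x - t) - 2 * f x - t ^ 2 * f₂ x) (by simp; ring)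
    (fun t => ((((hasDerivAt_comp_add (h₁ (x + t))).fun_add
      (hasDerivAt_comp_sub (h₁ (x - t)))).sub_const (2 * f x)).fun_sub
      ((hasDerivAt_pow 2 t).mul_const (f₂ x))).congr_deriv (by push_cast; ring)) b₂
  have b₀ := abs_le_pow_succ_of_abs_deriv_le (T := R) hB
    (φ := fun t => (∫ ξ in (x - t)..(x + t), f ξ) - t * (2 * f x) - t ^ 3 * (f₂ x / 3)) (by simp)
    (fun t => (((hasDerivAt_integral_symm hf x t).fun_sub
      ((hasDerivAt_id t).mul_const (2 * f x))).fun_sub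
      ((hasDerivAt_pow 3 t).mul_const (f₂ x / 3))).congr_deriv (by push_cast; ring)) b₁
    (η / 2) (by linarith) (by linarith)
  have e : avg η f x - f x - η ^ 2 / 24 * f₂ x
      = η⁻¹ * ((∫ ξ in (x - η / 2)..(x + η / 2), f ξ) - η / 2 * (2 * f x)
        - (η / 2) ^ 3 * (f₂ x / 3)) := by
    rw [avg]; field_simp; ring
  rw [e, abs_mul, abs_inv, abs_of_pos hη, inv_mul_le_iff₀ hη]
  refine b₀.trans ?_
  have : 0 ≤ K * L * E x * η ^ 5 := by positivity
  linarith

lemma abs_avg_avg_sub_le {f f₁ f₂ f₃ f₄ : ℝ → ℝ}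
    (hE : ∀ x t, |t| ≤ R → E (x + t) ≤ L * E x)
    (hE0 : ∀ x, 0 ≤ E x) (hL : 0 ≤ L) (hK : 0 ≤ K) (h₁ : ∀ x, HasDerivAt f (f₁ x) x)
    (h₂ : ∀ x, HasDerivAt f₁ (f₂ x) x) (h₃ : ∀ x, HasDerivAt f₂ (f₃ x) x)
    (h₄ : ∀ x, HasDerivAt f₃ (f₄ x) x) (hf₄ : ∀ x, |f₄ x| ≤ K * E x)
    {η : ℝ} (hη : 0 < η) (hηR : η ≤ R) (x : ℝ) :
    |avg η (avg η f) x - f x - η ^ 2 / 12 * f₂ x| ≤ K * L * (L + 2) * η ^ 4 * E x := by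
  have hf : Continuous f := continuous_iff_continuousAt.2 fun x => (h₁ x).continuousAt
  have hf₂ : Continuous f₂ := continuous_iff_continuousAt.2 fun x => (h₃ x).continuousAt
  have r := abs_avg_sub_sub_le hE hE0 hL hK h₁ h₂ h₃ h₄ hf₄ hη hηR
  have r₂ := abs_avg_sub_le hE hE0 hL hK h₃ h₄ hf₄ hη hηR x
  have a := abs_avg_le (K := K * L * η ^ 4) hE (by positivity)
    (fun y => (r y).trans_eq (by ring)) hη hηR x
  have lin : avg η (fun y => avg η f y - f y - η ^ 2 / 24 * f₂ y) x
      = avg η (avg η f) x - avg η f x - η ^ 2 / 24 * avg η f₂ x := by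
    have c := continuous_avg hf η
    rw [avg_sub (c.fun_sub hf) (by fun_prop), avg_sub c hf,
      avg_const_mul]
  rw [lin] at a
  have r₀ := r x
  have hN : 0 ≤ K * L * E x * η ^ 4 := by have := hE0 x; positivity
  have r₂' : |η ^ 2 / 24 * (avg η f₂ x - f₂ x)| ≤ K * L * E x * η ^ 4 := by
    rw [abs_mul, abs_of_nonneg (by positivity)]
    calc η ^ 2 / 24 * |avg η f₂ x - f₂ x| ≤ η ^ 2 / 24 * (K * L * E x * η ^ 2) := by gcongr
      _ ≤ _ := by linarith
  rw [abs_le] at *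
  constructor <;> nlinarith

lemma abs_avg_sq_avg_sub_le {f f₁ f₂ : ℝ → ℝ}
    (hE : ∀ x t, |t| ≤ R → E (x + t) ≤ L * E x)
    (hE0 : ∀ x, 0 ≤ E x) (hE1 : ∀ x, E x ≤ 1) (hL : 0 ≤ L) (hK : 0 ≤ K)
    (h₁ : ∀ x, HasDerivAt f (f₁ x) x)
    (h₂ : ∀ x, HasDerivAt f₁ (f₂ x) x) (hf₀ : ∀ x, |f x| ≤ K * E x)
    (hf₁ : ∀ x, |f₁ x| ≤ K * E x) (hf₂ : ∀ x, |f₂ x| ≤ K * E x)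
    {η : ℝ} (hη : 0 < η) (hηR : η ≤ R) (x : ℝ) :
    |avg η (fun y => avg η f y ^ 2) x - f x ^ 2|
      ≤ (K ^ 2 * L ^ 2 * (L + 1) + 4 * K ^ 2 * L) * η ^ 2 * E x := by
  have hf : Continuous f := continuous_iff_continuousAt.2 fun x => (h₁ x).continuousAt
  have hle : ∀ {c : ℝ} y, 0 ≤ c → c * E y ≤ c := fun y hc => mul_le_of_le_one_right hc (hE1 y)
  have r := abs_avg_sub_le hE hE0 hL hK h₁ h₂ hf₂ hη hηR
  have a := abs_avg_le hE hK hf₀ hη hηR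
  have d : ∀ y, |avg η f y ^ 2 - f y ^ 2| ≤ K ^ 2 * L * (L + 1) * η ^ 2 * E y := fun y => by
    have hs : |avg η f y + f y| ≤ K * (L + 1) := by
      have := abs_add_le (avg η f y) (f y)
      have := a y
      have := hf₀ y
      have := hle (c := K * L) y (by positivity)
      have := hle y hK
      linarith
    rw [show avg η f y ^ 2 - f y ^ 2 = (avg η f y - f y) * (avg η f y + f y) by ring, abs_mul]
    have := hE0 y
    calc _ ≤ K * L * E y * η ^ 2 * (K * (L + 1)) := by
          gcongr
          exact r y
      _ = _ := by ring
  have a₂ := abs_avg_le hE (by positivity) d hη hηR x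
  have c₁ := continuous_avg hf η
  rw [avg_sub (by fun_prop) (by fun_prop)] at a₂
  have s := abs_avg_sub_le (K := 4 * K ^ 2) (f := fun y => f y ^ 2)
    (f₁ := fun y => 2 * f y * f₁ y) (f₂ := fun y => 2 * (f₁ y * f₁ y + f y * f₂ y))
    hE hE0 hL (by positivity) (fun y => by simpa using (h₁ y).fun_pow 2)
    (fun y => (((h₁ y).const_mul 2).fun_mul (h₂ y)).congr_deriv (by ring))
    (fun y => by
      have m : ∀ u v : ℝ, |u| ≤ K * E y → |v| ≤ K * E y → |u * v| ≤ K ^ 2 * E y :=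
        fun u v hu hv => by
        have := hE0 y
        rw [abs_mul]
        calc |u| * |v| ≤ (K * E y) * (K * E y) := by gcongr
          _ = (K ^ 2 * E y) * E y := by ring
          _ ≤ K ^ 2 * E y := hle y (by positivity)
      have m₁ := m _ _ (hf₁ y) (hf₁ y)
      have m₂ := m _ _ (hf₀ y) (hf₂ y)
      have := abs_add_le (f₁ y * f₁ y) (f y * f₂ y)
      rw [abs_mul, abs_two]
      linarith) hη hηR x
  rw [abs_le] at *
  constructor <;> nlinarith

end Weighted

section SolitaryWave

variable {b : ℝ}

lemma hasDerivAt_sech_sq (b x : ℝ) :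
    HasDerivAt (fun x => (Real.cosh (b * x))⁻¹ ^ 2)
      (-2 * b * (Real.cosh (b * x))⁻¹ ^ 2 * Real.tanh (b * x)) x := by
  have hc := (Real.cosh_pos (b * x)).ne'
  refine ((((Real.hasDerivAt_cosh (b * x)).comp x
    ((hasDerivAt_id x).const_mul b)).inv hc).fun_pow 2).congr_deriv ?_
  simp [Real.tanh_eq_sinh_div_cosh]
  field_simp

lemma hasDerivAt_tanh_mul (b x : ℝ) :
    HasDerivAt (fun x => Real.tanh (b * x)) (b * (Real.cosh (b * x))⁻¹ ^ 2) x := by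
  have hc := (Real.cosh_pos (b * x)).ne'
  have hb := (hasDerivAt_id x).const_mul b
  have h := ((Real.hasDerivAt_sinh (b * x)).comp x hb).div
    ((Real.hasDerivAt_cosh (b * x)).comp x hb) hc
  have e : (fun x => Real.tanh (b * x))
      = (Real.sinh ∘ fun y => b * id y) / (Real.cosh ∘ fun y => b * id y) := by
    funext y; simp [Real.tanh_eq_sinh_div_cosh]
  rw [e]
  refine h.congr_deriv ?_
  have := Real.cosh_sq (b * x)
  simp
  field_simp
  linear_combination b * this

lemma tanh_sq_eq (u : ℝ) : Real.tanh u ^ 2 = 1 - (Real.cosh u)⁻¹ ^ 2 := by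
  have hc := (Real.cosh_pos u).ne'
  rw [Real.tanh_eq_sinh_div_cosh]
  field_simp
  linarith [Real.cosh_sq u]

lemma sech_sq_le_one (u : ℝ) : (Real.cosh u)⁻¹ ^ 2 ≤ 1 :=
  pow_le_one₀ (inv_nonneg.2 (Real.cosh_pos u).le) (inv_le_one_of_one_le₀ (Real.one_le_cosh u))

lemma cosh_le_exp_mul_cosh_add (u t : ℝ) :
    Real.cosh u ≤ Real.exp |t| * Real.cosh (u + t) := by
  rw [Real.cosh_eq, Real.cosh_eq, neg_add, Real.exp_add, Real.exp_add]
  have h1 : 1 ≤ Real.exp |t| * Real.exp t := by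
    rw [← Real.exp_add]
    exact Real.one_le_exp (by linarith [neg_abs_le t])
  have h2 : 1 ≤ Real.exp |t| * Real.exp (-t) := by
    rw [← Real.exp_add]
    exact Real.one_le_exp (by linarith [le_abs_self t])
  nlinarith [Real.exp_pos u, Real.exp_pos (-u)]

lemma sech_sq_add_le (hb : 0 ≤ b) {R : ℝ} (x t : ℝ) (ht : |t| ≤ R) :
    (Real.cosh (b * (x + t)))⁻¹ ^ 2 ≤ Real.exp (b * R) ^ 2 * (Real.cosh (b * x))⁻¹ ^ 2 := by
  rw [← mul_pow]
  have h1 := Real.cosh_pos (b * x)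
  have h2 := Real.cosh_pos (b * (x + t))
  refine pow_le_pow_left₀ (inv_nonneg.2 h2.le) ?_ 2
  rw [← div_eq_mul_inv, le_div_iff₀ h1, inv_mul_le_iff₀ h2]
  have h := cosh_le_exp_mul_cosh_add (b * x) (b * t)
  rw [← mul_add] at h
  have : Real.exp |b * t| ≤ Real.exp (b * R) := by
    rw [abs_mul, abs_of_nonneg hb]
    gcongr
  nlinarith

lemma memLp_sech_sq (hb : 0 < b) :
    MemLp (fun x => (Real.cosh (b * x))⁻¹ ^ 2) 2 volume := by
  have hc : Continuous fun x => (Real.cosh (b * x))⁻¹ ^ 2 :=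
    continuous_iff_continuousAt.2 fun x => (hasDerivAt_sech_sq b x).continuousAt
  rw [memLp_two_iff_integrable_sq hc.aestronglyMeasurable]
  refine (integrable_inv_one_add_sq.comp_mul_left' hb.ne').mono'
    (hc.pow 2).aestronglyMeasurable (ae_of_all _ fun x => ?_)
  have h0 : 0 ≤ (Real.cosh (b * x))⁻¹ ^ 2 := by positivity
  rw [Real.norm_eq_abs, abs_of_nonneg (by positivity)]
  refine (pow_le_of_le_one h0 (sech_sq_le_one _) two_ne_zero).trans ?_
  rw [inv_pow]
  refine inv_anti₀ (by positivity) ?_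
  rw [Real.cosh_sq]
  have : |b * x| ≤ |Real.sinh (b * x)| := by
    rw [Real.abs_sinh]
    exact Real.self_le_sinh_iff.2 (abs_nonneg _)
  linarith [sq_le_sq.2 this]

lemma abs_tanh_le_one (u : ℝ) : |Real.tanh u| ≤ 1 := by
  rw [← sq_le_one_iff_abs_le_one, tanh_sq_eq]
  have : 0 ≤ (Real.cosh u)⁻¹ ^ 2 := by positivity
  linarith

end SolitaryWave

/-- The solitary wave solves `W'' = d₁ W - d₂ W ^ 2`, and its first four derivatives are
dominated by a multiple of the wave's `sech ^ 2` profile. -/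
lemma exists_derivs_W0 {d1 d2 : ℝ} (hd1 : 0 < d1) (hd2 : 0 < d2) :
    ∃ f₁ f₃ f₄ : ℝ → ℝ, ∃ K : ℝ, 0 ≤ K ∧
      (∀ x, HasDerivAt (W0 d1 d2) (f₁ x) x) ∧
      (∀ x, HasDerivAt f₁ (d1 * W0 d1 d2 x - d2 * W0 d1 d2 x ^ 2) x) ∧
      (∀ x, HasDerivAt (fun x => d1 * W0 d1 d2 x - d2 * W0 d1 d2 x ^ 2) (f₃ x) x) ∧
      (∀ x, HasDerivAt f₃ (f₄ x) x) ∧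
      (∀ x, |W0 d1 d2 x| ≤ K * (Real.cosh (Real.sqrt d1 / 2 * x))⁻¹ ^ 2) ∧
      (∀ x, |f₁ x| ≤ K * (Real.cosh (Real.sqrt d1 / 2 * x))⁻¹ ^ 2) ∧
      (∀ x, |d1 * W0 d1 d2 x - d2 * W0 d1 d2 x ^ 2|
        ≤ K * (Real.cosh (Real.sqrt d1 / 2 * x))⁻¹ ^ 2) ∧
      (∀ x, |f₄ x| ≤ K * (Real.cosh (Real.sqrt d1 / 2 * x))⁻¹ ^ 2) := by
  set b := Real.sqrt d1 / 2 with hb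
  have hbpos : 0 < b := by positivity
  have hb2 : d1 = 4 * b ^ 2 := by
    rw [hb, div_pow, Real.sq_sqrt hd1.le]; ring
  set A := 3 * d1 / (2 * d2) with hA
  have hApos : 0 < A := by positivity
  have hAd : A * d2 = 6 * b ^ 2 := by
    rw [hA, hb2]; field_simp; ring
  set S : ℝ → ℝ := fun x => (Real.cosh (b * x))⁻¹ ^ 2 with hS
  set T : ℝ → ℝ := fun x => Real.tanh (b * x) with hT
  have hW : W0 d1 d2 = fun x => A * S x := by
    funext x
    simp only [W0, hS, hA, hb]
    rw [show Real.sqrt d1 * x / 2 = Real.sqrt d1 / 2 * x by ring]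
  have hdS : ∀ x, HasDerivAt S (-2 * b * S x * T x) x := hasDerivAt_sech_sq b
  have hdT : ∀ x, HasDerivAt T (b * S x) x := hasDerivAt_tanh_mul b
  have hTS : ∀ x, T x ^ 2 = 1 - S x := fun x => tanh_sq_eq _
  have hS0 : ∀ x, 0 ≤ S x := fun x => by positivity
  have hS1 : ∀ x, S x ≤ 1 := fun x => sech_sq_le_one _
  have hT1 : ∀ x, |T x| ≤ 1 := fun x => abs_tanh_le_one _
  have key : ∀ p q r x, |p * S x + q * S x ^ 2 + r * S x ^ 3| ≤ (|p| + |q| + |r|) * S x := by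
    intro p q r x
    have h2 : S x ^ 2 ≤ S x := pow_le_of_le_one (hS0 x) (hS1 x) two_ne_zero
    have h3 : S x ^ 3 ≤ S x := pow_le_of_le_one (hS0 x) (hS1 x) three_ne_zero
    refine (abs_add_three _ _ _).trans ?_
    rw [abs_mul, abs_mul, abs_mul, abs_of_nonneg (hS0 x), abs_of_nonneg (pow_nonneg (hS0 x) 2),
      abs_of_nonneg (pow_nonneg (hS0 x) 3)]
    nlinarith [abs_nonneg p, abs_nonneg q, abs_nonneg r]
  -- The second derivative is `A * (4 b² S - 6 b² S²)`; the others follow by the product rule.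
  have hW2 : (fun x => d1 * W0 d1 d2 x - d2 * W0 d1 d2 x ^ 2)
      = fun x => A * b ^ 2 * (4 * S x - 6 * S x ^ 2) := by
    funext x
    rw [hW]
    simp only
    linear_combination A * S x * hb2 - A * S x ^ 2 * hAd
  have hW2' : ∀ x, d1 * W0 d1 d2 x - d2 * W0 d1 d2 x ^ 2
      = A * b ^ 2 * (4 * S x - 6 * S x ^ 2) := congrFun hW2
  refine ⟨fun x => A * (-2 * b * S x * T x), fun x => A * b ^ 3 * ((24 * S x ^ 2 - 8 * S x) * T x),
    fun x => A * b ^ 4 * (16 * S x - 120 * S x ^ 2 + 120 * S x ^ 3),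
    A + A * (2 * b) + A * b ^ 2 * 10 + A * b ^ 4 * 256, by positivity, ?_, ?_, ?_, ?_, ?_, ?_, ?_, ?_⟩
  · intro x
    rw [hW]
    exact (hdS x).const_mul A
  · intro x
    rw [hW2' x]
    refine HasDerivAt.congr_deriv ((((hdS x).const_mul (-2 * b)).fun_mul (hdT x)).const_mul A) ?_
    linear_combination (4 * A * b ^ 2 * S x) * hTS x
  · intro x
    rw [hW2]
    refine HasDerivAt.congr_deriv ((((hdS x).const_mul 4).fun_sub (((hdS x).fun_pow 2).const_mul
      6)).const_mul (A * b ^ 2)) ?_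
    push_cast
    ring
  · intro x
    refine HasDerivAt.congr_deriv ((((((hdS x).fun_pow 2).const_mul 24).fun_sub
      ((hdS x).const_mul 8)).fun_mul (hdT x)).const_mul (A * b ^ 3)) ?_
    simp
    linear_combination (A * b ^ 4 * (16 * S x - 96 * S x ^ 2)) * hTS x
  all_goals
    intro x
    have n0 := hS0 x
    have q0 : 0 ≤ A * S x := by positivity
    have q1 : 0 ≤ A * (2 * b) * S x := by positivity
    have q2 : 0 ≤ A * b ^ 2 * S x := by positivity
    have q4 : 0 ≤ A * b ^ 4 * S x := by positivity
  · rw [hW]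
    simp only
    rw [abs_of_nonneg q0]
    linarith
  · have : |A * (-2 * b * S x * T x)| = A * (2 * b) * S x * |T x| := by
      rw [show A * (-2 * b * S x * T x) = -(A * (2 * b) * S x * T x) by ring, abs_neg, abs_mul,
        abs_of_nonneg q1]
    rw [this]
    have := mul_le_of_le_one_right q1 (hT1 x)
    linarith
  · rw [hW2' x, abs_mul, abs_of_pos (by positivity : 0 < A * b ^ 2)]
    have h := key 4 (-6) 0 x
    norm_num at h
    rw [← sub_eq_add_neg] at h
    have := mul_le_mul_of_nonneg_left h (by positivity : 0 ≤ A * b ^ 2)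
    linarith
  · rw [abs_mul, abs_of_pos (by positivity : 0 < A * b ^ 4)]
    have h := key 16 (-120) 120 x
    norm_num at h
    rw [← sub_eq_add_neg] at h
    have := mul_le_mul_of_nonneg_left h (by positivity : 0 ≤ A * b ^ 4)
    linarith

/-- The `ε`-residual of the KdV wave `W₀` is of order `ε²`:
`‖ε⁻²(𝒬_ε[W₀] - ℬ_ε W₀)‖₂ ≤ C` uniformly for `0 < ε ≤ 1`. -/
theorem residual_estimate (M : ℕ) (hM : 1 ≤ M) (α β : ℕ → ℝ)
    (hα : ∀ m ∈ Finset.Icc 1 M, 0 < α m) (hβ : ∀ m ∈ Finset.Icc 1 M, 0 < β m) :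
    ∃ C : ℝ, 0 < C ∧ ∀ ε : ℝ, 0 < ε → ε ≤ 1 →
      eLpNorm (fun x =>
        (Qop M β ε (W0 (12 / ∑ m ∈ Finset.Icc 1 M, α m * (m : ℝ) ^ 4)
            ((12 * ∑ m ∈ Finset.Icc 1 M, β m * (m : ℝ) ^ 3) /
              ∑ m ∈ Finset.Icc 1 M, α m * (m : ℝ) ^ 4)) x
          - Bop M α ε (W0 (12 / ∑ m ∈ Finset.Icc 1 M, α m * (m : ℝ) ^ 4)
            ((12 * ∑ m ∈ Finset.Icc 1 M, β m * (m : ℝ) ^ 3) /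
              ∑ m ∈ Finset.Icc 1 M, α m * (m : ℝ) ^ 4)) x) / ε ^ 2) 2 volume
        ≤ ENNReal.ofReal C := by
  set Sα := ∑ m ∈ Finset.Icc 1 M, α m * (m : ℝ) ^ 4 with hSα
  set Sβ := ∑ m ∈ Finset.Icc 1 M, β m * (m : ℝ) ^ 3 with hSβ
  have hm : ∀ m ∈ Finset.Icc 1 M, (0 : ℝ) < m := fun m h =>
    Nat.cast_pos.2 (Finset.mem_Icc.1 h).1
  have hne : (Finset.Icc 1 M).Nonempty := Finset.nonempty_Icc.2 hM
  have hSα0 : 0 < Sα := Finset.sum_pos (fun m h => mul_pos (hα m h) (pow_pos (hm m h) 4)) hne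
  have hSβ0 : 0 < Sβ := Finset.sum_pos (fun m h => mul_pos (hβ m h) (pow_pos (hm m h) 3)) hne
  set d1 := 12 / Sα with hd1
  set d2 := 12 * Sβ / Sα with hd2
  have hd1' : 0 < d1 := by positivity
  have hd2' : 0 < d2 := by positivity
  obtain ⟨f₁, f₃, f₄, K, hK, h₁, h₂, h₃, h₄, k₀, k₁, k₂, k₄⟩ := exists_derivs_W0 hd1' hd2'
  set W := W0 d1 d2 with hW
  set b := Real.sqrt d1 / 2 with hb
  have hb0 : 0 < b := by positivity
  set E : ℝ → ℝ := fun x => (Real.cosh (b * x))⁻¹ ^ 2 with hEdef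
  set L := Real.exp (b * M) ^ 2 with hL
  have hL0 : 0 ≤ L := by positivity
  have hE : ∀ x t, |t| ≤ (M : ℝ) → E (x + t) ≤ L * E x := sech_sq_add_le hb0.le
  have hE0 : ∀ x, 0 ≤ E x := fun x => by positivity
  have hE1 : ∀ x, E x ≤ 1 := fun x => sech_sq_le_one _
  set K₁ := K * L * (L + 2) with hK₁
  set K₂ := K ^ 2 * L ^ 2 * (L + 1) + 4 * K ^ 2 * L with hK₂
  set C := ∑ m ∈ Finset.Icc 1 M,
    (β m * (m : ℝ) ^ 3 * (K₂ * (m : ℝ) ^ 2) + α m * (m : ℝ) ^ 2 * (K₁ * (m : ℝ) ^ 4)) with hC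
  have hLp : MemLp (fun x => C * E x) 2 volume := (memLp_sech_sq hb0).const_mul C
  refine ⟨(eLpNorm (fun x => C * E x) 2 volume).toReal + 1, by positivity, fun ε hε hε1 => ?_⟩
  refine (eLpNorm_mono_real (g := fun x => C * E x) fun x => ?_).trans ?_
  swap
  · exact (ENNReal.le_ofReal_iff_toReal_le hLp.2.ne (by positivity)).2 (by linarith)
  rw [Real.norm_eq_abs, abs_div, abs_of_pos (by positivity : 0 < ε ^ 2),
    div_le_iff₀ (by positivity)]
  -- The leading-order terms cancel because `W` solves the limiting equation.
  have ode : W x = Sβ * W x ^ 2 + Sα / 12 * (d1 * W x - d2 * W x ^ 2) := by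
    rw [hd1, hd2]
    field_simp
    ring
  have expand : Qop M β ε W x - Bop M α ε W x = ∑ m ∈ Finset.Icc 1 M,
      (β m * (m : ℝ) ^ 3 *
          (avg ((m : ℝ) * ε) (fun y => avg ((m : ℝ) * ε) W y ^ 2) x - W x ^ 2)
        + α m * (m : ℝ) ^ 2 / ε ^ 2 * (avg ((m : ℝ) * ε) (avg ((m : ℝ) * ε) W) x - W x
          - ((m : ℝ) * ε) ^ 2 / 12 * (d1 * W x - d2 * W x ^ 2))) := by
    have e : ∀ m ∈ Finset.Icc 1 M, (β m * (m : ℝ) ^ 3 *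
          (avg ((m : ℝ) * ε) (fun y => avg ((m : ℝ) * ε) W y ^ 2) x - W x ^ 2)
        + α m * (m : ℝ) ^ 2 / ε ^ 2 * (avg ((m : ℝ) * ε) (avg ((m : ℝ) * ε) W) x - W x
          - ((m : ℝ) * ε) ^ 2 / 12 * (d1 * W x - d2 * W x ^ 2)))
        = β m * (m : ℝ) ^ 3 * avg ((m : ℝ) * ε) (fun y => avg ((m : ℝ) * ε) W y ^ 2) x
          - α m * (m : ℝ) ^ 2 / ε ^ 2 * (W x - avg ((m : ℝ) * ε) (avg ((m : ℝ) * ε) W) x)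
          - β m * (m : ℝ) ^ 3 * W x ^ 2
          - α m * (m : ℝ) ^ 4 * ((d1 * W x - d2 * W x ^ 2) / 12) := fun m _ => by
      field_simp
      ring
    rw [Finset.sum_congr rfl e, Finset.sum_sub_distrib, Finset.sum_sub_distrib,
      Finset.sum_sub_distrib, ← Finset.sum_mul, ← Finset.sum_mul, ← hSα, ← hSβ, Qop, Bop]
    linarith
  rw [expand, hC, Finset.sum_mul, Finset.sum_mul]
  refine (Finset.abs_sum_le_sum_abs _ _).trans (Finset.sum_le_sum fun m h => ?_)
  have hm0 := hm m h
  have hη : 0 < (m : ℝ) * ε := by positivity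
  have hηM : (m : ℝ) * ε ≤ M := (mul_le_of_le_one_right hm0.le hε1).trans
    (Nat.cast_le.2 (Finset.mem_Icc.1 h).2)
  have q := abs_avg_sq_avg_sub_le hE hE0 hE1 hL0 hK h₁ h₂ k₀ k₁ k₂ hη hηM x
  have p := abs_avg_avg_sub_le hE hE0 hL0 hK h₁ h₂ h₃ h₄ k₄ hη hηM x
  have cβ : 0 ≤ β m * (m : ℝ) ^ 3 := mul_nonneg (hβ m h).le (by positivity)
  have cα : 0 ≤ α m * (m : ℝ) ^ 2 / ε ^ 2 :=
    div_nonneg (mul_nonneg (hα m h).le (by positivity)) (by positivity)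
  refine (abs_add_le _ _).trans ?_
  rw [abs_mul (β m * _), abs_mul (α m * _ / _), abs_of_nonneg cβ, abs_of_nonneg cα]
  refine (add_le_add (mul_le_mul_of_nonneg_left q cβ) (mul_le_mul_of_nonneg_left p cα)).trans_eq ?_
  rw [← hK₁, ← hK₂]
  field_simp
end
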